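/- arXiv:math/0502211 — 2 statements merged into one kernel-verified Lean document; each statement's English description precedes it below -/
import Mathlib

section
/- If D is a separable, unital, strongly self-absorbing C*-algebra, then D has approximately inner half flip, i.e., the two unital embeddings id_D ⊗ 1_D and 1_D ⊗ id_D of D into the minimal tensor product D ⊗ D are approximately unitarily equivalent. -/
open scoped MultiplierAlgebra TensorProduct
open Filter Topology

noncomputable section

universe u v w x

/-- Approximate unitary equivalence of two maps `φ ψ : A → B`, witnessed by a sequence of
unitaries in the multiplier algebra `𝓜(ℂ, B)` (in which `B` embeds canonically). -/
def ApproxUnitaryEquiv {A : Type u} {B : Type v} [NonUnitalCStarAlgebra B]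
    (φ ψ : A → B) : Prop :=
  ∃ v : ℕ → 𝓜(ℂ, B), (∀ n, v n ∈ unitary 𝓜(ℂ, B)) ∧
    ∀ a : A, Tendsto
      (fun n => ‖star (v n) * (φ a : 𝓜(ℂ, B)) * v n - (ψ a : 𝓜(ℂ, B))‖)
      atTop (𝓝 (0 : ℝ))

/-- Data exhibiting `T` as a C*-tensor product of `A` and `B`: a bilinear, multiplicative,
star-preserving, cross-normed map `A × B → T` with dense span. -/
structure CStarTensor (A : Type u) (B : Type v) (T : Type w) [NonUnitalCStarAlgebra A]
    [NonUnitalCStarAlgebra B] [NonUnitalCStarAlgebra T] where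
  tmul : A → B → T
  add_left : ∀ a a' b, tmul (a + a') b = tmul a b + tmul a' b
  add_right : ∀ a b b', tmul a (b + b') = tmul a b + tmul a b'
  smul_left : ∀ (c : ℂ) a b, tmul (c • a) b = c • tmul a b
  smul_right : ∀ (c : ℂ) a b, tmul a (c • b) = c • tmul a b
  mul_tmul : ∀ a a' b b', tmul a b * tmul a' b' = tmul (a * a') (b * b')
  star_tmul : ∀ a b, star (tmul a b) = tmul (star a) (star b)
  norm_tmul : ∀ a b, ‖tmul a b‖ = ‖a‖ * ‖b‖
  dense_span : Dense ((Submodule.span ℂ {t : T | ∃ a b, tmul a b = t} : Submodule ℂ T) : Set T)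

/-- Data exhibiting `T` as *the minimal (spatial) tensor product* of `A` and `B`: a C*-tensor
product which is dominated by every other C*-tensor product of `A` and `B` (i.e., it carries
the smallest C*-norm). -/
structure MinTensor (A : Type u) (B : Type v) (T : Type w) [NonUnitalCStarAlgebra A]
    [NonUnitalCStarAlgebra B] [NonUnitalCStarAlgebra T] extends CStarTensor A B T where
  minimal : ∀ (T' : Type (max u v)) [NonUnitalCStarAlgebra T'] (h : CStarTensor A B T'),
    ∃ π : T' →⋆ₙₐ[ℂ] T, ∀ a b, π (h.tmul a b) = tmul a b

/-- The first-factor unital embedding `d ↦ d ⊗ 1`. -/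
def MinTensor.fst {D : Type u} {E : Type v} {T : Type w} [CStarAlgebra D] [CStarAlgebra E]
    [CStarAlgebra T] (h : MinTensor D E T) : D → T := fun d => h.tmul d 1

/-- The second-factor unital embedding `d ↦ 1 ⊗ d`. -/
def MinTensor.snd {D : Type u} {E : Type v} {T : Type w} [CStarAlgebra D] [CStarAlgebra E]
    [CStarAlgebra T] (h : MinTensor D E T) : E → T := fun d => h.tmul 1 d

/-- A unital C*-algebra `D` has *approximately inner half flip* (with respect to a
realization `T` of the minimal tensor product `D ⊗ D`) if the two factor embeddings
`id_D ⊗ 1_D` and `1_D ⊗ id_D` of `D` into `D ⊗ D` are approximately unitarily equivalent. -/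
def HasApproxInnerHalfFlip {D : Type u} {T : Type w} [CStarAlgebra D] [CStarAlgebra T]
    (h : MinTensor D D T) : Prop :=
  ApproxUnitaryEquiv h.fst h.snd

/-- A unital C*-algebra `D` has *approximately inner flip* (with respect to a realization
`T` of `D ⊗ D`) if the flip automorphism `σ_D : a ⊗ b ↦ b ⊗ a` of `D ⊗ D` is approximately
unitarily equivalent to the identity map. -/
def HasApproxInnerFlip {D : Type u} {T : Type w} [CStarAlgebra D] [CStarAlgebra T]
    (h : MinTensor D D T) : Prop :=
  ∃ σ : T ≃⋆ₐ[ℂ] T, (∀ a b, σ (h.tmul a b) = h.tmul b a) ∧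
    ApproxUnitaryEquiv (⇑σ) (id : T → T)

/-- A unital C*-algebra `D ≇ ℂ` is *strongly self-absorbing* (with respect to a realization
`T` of the minimal tensor product `D ⊗ D`) if there is an isomorphism `φ : D → D ⊗ D` which
is approximately unitarily equivalent to `id_D ⊗ 1_D`. -/
def IsStronglySelfAbsorbing {D : Type u} {T : Type w} [CStarAlgebra D] [CStarAlgebra T]
    (h : MinTensor D D T) : Prop :=
  IsEmpty (D ≃⋆ₐ[ℂ] ℂ) ∧ ∃ φ : D ≃⋆ₐ[ℂ] T, ApproxUnitaryEquiv (⇑φ) h.fst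

namespace DoubleCentralizer

/-- The canonical map of a unital C*-algebra into its multiplier algebra is bijective. -/
theorem coeHom_bijective (B : Type v) [CStarAlgebra B] :
    Function.Bijective (coeHom : B →⋆ₙₐ[ℂ] 𝓜(ℂ, B)) := by
  refine ⟨fun a b hab => ?_, fun m => ⟨m.fst 1, ?_⟩⟩
  · have h1 := congrArg (fun m : 𝓜(ℂ, B) => m.fst 1) hab
    simpa using h1
  · have key : m.snd 1 = m.fst 1 := by simpa using m.central 1 1
    refine DoubleCentralizer.ext ℂ B _ _ (Prod.ext ?_ ?_)
    · refine ContinuousLinearMap.ext fun y => ?_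
      simpa [key] using m.central 1 y
    · refine ContinuousLinearMap.ext fun y => ?_
      simpa using (m.central y 1).symm

/-- A unital C*-algebra is its own multiplier algebra. -/
def coeEquiv (B : Type v) [CStarAlgebra B] : B ≃⋆ₐ[ℂ] 𝓜(ℂ, B) :=
  StarAlgEquiv.ofBijective (coeHom : B →⋆ₙₐ[ℂ] 𝓜(ℂ, B)) (coeHom_bijective B)

theorem coeEquiv_apply {B : Type v} [CStarAlgebra B] (b : B) :
    coeEquiv B b = (b : 𝓜(ℂ, B)) := rfl

end DoubleCentralizer

theorem approxUnitaryEquiv_iff {A : Type u} {B : Type v} [CStarAlgebra B] {φ ψ : A → B} :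
    ApproxUnitaryEquiv φ ψ ↔ ∃ v : ℕ → B, (∀ n, v n ∈ unitary B) ∧
      ∀ a, Tendsto (fun n => star (v n) * φ a * v n) atTop (𝓝 (ψ a)) := by
  have norm_eq (u x y : B) :
      ‖star (DoubleCentralizer.coeEquiv B u) * (x : 𝓜(ℂ, B)) * DoubleCentralizer.coeEquiv B u
        - (y : 𝓜(ℂ, B))‖ = ‖star u * x * u - y‖ := by
    rw [← DoubleCentralizer.coeEquiv_apply, ← DoubleCentralizer.coeEquiv_apply, ← map_star,
      ← map_mul, ← map_mul, ← map_sub, StarAlgEquiv.norm_map]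
  constructor
  · rintro ⟨v, hv, hlim⟩
    refine ⟨fun n => (DoubleCentralizer.coeEquiv B).symm (v n),
      fun n => Unitary.map_mem (DoubleCentralizer.coeEquiv B).symm (hv n), fun a => ?_⟩
    rw [tendsto_iff_norm_sub_tendsto_zero]
    refine (hlim a).congr fun n => ?_
    rw [← norm_eq, StarAlgEquiv.apply_symm_apply]
  · rintro ⟨v, hv, hlim⟩
    refine ⟨fun n => DoubleCentralizer.coeEquiv B (v n),
      fun n => Unitary.map_mem (DoubleCentralizer.coeEquiv B) (hv n), fun a => ?_⟩
    refine (tendsto_iff_norm_sub_tendsto_zero.1 (hlim a)).congr fun n => ?_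
    rw [← norm_eq]

namespace ApproxUnitaryEquiv

variable {A : Type u} {B : Type v} {C : Type w} [CStarAlgebra B] [CStarAlgebra C]

theorem symm {φ ψ : A → B} (hφψ : ApproxUnitaryEquiv φ ψ) : ApproxUnitaryEquiv ψ φ := by
  obtain ⟨v, hv, hlim⟩ := approxUnitaryEquiv_iff.1 hφψ
  refine approxUnitaryEquiv_iff.2 ⟨fun n => star (v n), fun n => Unitary.star_mem (hv n),
    fun a => ?_⟩
  have h0 := tendsto_iff_norm_sub_tendsto_zero.1 (hlim a)
  refine tendsto_iff_norm_sub_tendsto_zero.2 (h0.congr fun n => ?_)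
  have e : star (star (v n)) * ψ a * star (v n) - φ a
      = -(v n * (star (v n) * φ a * v n - ψ a) * star (v n)) := by
    have h1 := Unitary.mul_star_self_of_mem (hv n)
    calc _ = v n * ψ a * star (v n) - (v n * star (v n)) * φ a * (v n * star (v n)) := by
          rw [h1, star_star, one_mul, mul_one]
      _ = _ := by noncomm_ring
  rw [e, norm_neg, CStarRing.norm_mul_mem_unitary _ (Unitary.star_mem (hv n)),
    CStarRing.norm_mem_unitary_mul _ (hv n)]

theorem trans {φ ψ χ : A → B} (hφψ : ApproxUnitaryEquiv φ ψ) (hψχ : ApproxUnitaryEquiv ψ χ) :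
    ApproxUnitaryEquiv φ χ := by
  obtain ⟨v, hv, hv_lim⟩ := approxUnitaryEquiv_iff.1 hφψ
  obtain ⟨u, hu, hu_lim⟩ := approxUnitaryEquiv_iff.1 hψχ
  refine approxUnitaryEquiv_iff.2 ⟨fun n => v n * u n, fun n => mul_mem (hv n) (hu n),
    fun a => ?_⟩
  have h0 : Tendsto (fun n => star (u n) * (star (v n) * φ a * v n - ψ a) * u n)
      atTop (𝓝 0) := by
    refine tendsto_zero_iff_norm_tendsto_zero.2
      ((tendsto_iff_norm_sub_tendsto_zero.1 (hv_lim a)).congr fun n => ?_)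
    rw [CStarRing.norm_mul_mem_unitary _ (hu n),
      CStarRing.norm_mem_unitary_mul _ (Unitary.star_mem (hu n))]
  have h1 := h0.add (hu_lim a)
  rw [zero_add] at h1
  refine h1.congr fun n => ?_
  rw [star_mul]
  noncomm_ring

theorem comp_right {A' : Type x} {φ ψ : A → B} (hφψ : ApproxUnitaryEquiv φ ψ) (α : A' → A) :
    ApproxUnitaryEquiv (φ ∘ α) (ψ ∘ α) := by
  obtain ⟨v, hv, hlim⟩ := hφψ
  exact ⟨v, hv, fun a => hlim (α a)⟩

theorem comp_left {φ ψ : A → B} (hφψ : ApproxUnitaryEquiv φ ψ) (θ : B →⋆ₐ[ℂ] C) :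
    ApproxUnitaryEquiv (θ ∘ φ) (θ ∘ ψ) := by
  obtain ⟨v, hv, hlim⟩ := approxUnitaryEquiv_iff.1 hφψ
  refine approxUnitaryEquiv_iff.2 ⟨fun n => θ (v n), fun n => Unitary.map_mem θ (hv n),
    fun a => ?_⟩
  have hθ : Continuous θ :=
    AddMonoidHomClass.continuous_of_bound θ 1 fun b => by
      simpa using NonUnitalStarAlgHom.norm_apply_le θ b
  refine ((hθ.tendsto _).comp (hlim a)).congr fun n => ?_
  simp [map_star]

end ApproxUnitaryEquiv

namespace CStarTensor

variable {A : Type u} {B : Type v} {T : Type w} [NonUnitalCStarAlgebra A]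
  [NonUnitalCStarAlgebra B] [NonUnitalCStarAlgebra T]

/-- Exchanging the two factors of a C*-tensor product. -/
def swap (t : CStarTensor A B T) : CStarTensor B A T where
  tmul b a := t.tmul a b
  add_left b b' a := t.add_right a b b'
  add_right b a a' := t.add_left a a' b
  smul_left c b a := t.smul_right c a b
  smul_right c b a := t.smul_left c a b
  mul_tmul b b' a a' := t.mul_tmul a a' b b'
  star_tmul b a := t.star_tmul a b
  norm_tmul b a := by rw [t.norm_tmul, mul_comm]
  dense_span := by
    have e : {x : T | ∃ b a, t.tmul a b = x} = {x : T | ∃ a b, t.tmul a b = x} :=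
      Set.ext fun _ => exists_comm
    rw [e]
    exact t.dense_span

/-- Precomposing the first factor of a C*-tensor product with an isomorphism. -/
def congrLeft {A' : Type x} [NonUnitalCStarAlgebra A'] (t : CStarTensor A B T)
    (α : A' ≃⋆ₐ[ℂ] A) : CStarTensor A' B T where
  tmul a b := t.tmul (α a) b
  add_left a a' b := by rw [map_add, t.add_left]
  add_right a b b' := t.add_right _ b b'
  smul_left c a b := by rw [map_smul, t.smul_left]
  smul_right c a b := t.smul_right c _ b
  mul_tmul a a' b b' := by rw [t.mul_tmul, map_mul]
  star_tmul a b := by rw [t.star_tmul, map_star]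
  norm_tmul a b := by rw [t.norm_tmul, StarAlgEquiv.norm_map]
  dense_span := by
    have e : {x : T | ∃ a b, t.tmul (α a) b = x} = {x : T | ∃ a b, t.tmul a b = x} :=
      Set.ext fun _ => ((EquivLike.surjective α).exists (p := fun a => ∃ b, t.tmul a b = _)).symm
    rw [e]
    exact t.dense_span

/-- Transporting a C*-tensor product along an isomorphism. -/
def congr {T' : Type x} [NonUnitalCStarAlgebra T'] (t : CStarTensor A B T)
    (τ : T ≃⋆ₐ[ℂ] T') : CStarTensor A B T' where
  tmul a b := τ (t.tmul a b)
  add_left a a' b := by rw [t.add_left, map_add]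
  add_right a b b' := by rw [t.add_right, map_add]
  smul_left c a b := by rw [t.smul_left, map_smul]
  smul_right c a b := by rw [t.smul_right, map_smul]
  mul_tmul a a' b b' := by rw [← map_mul, t.mul_tmul]
  star_tmul a b := by rw [← map_star, t.star_tmul]
  norm_tmul a b := by rw [StarAlgEquiv.norm_map, t.norm_tmul]
  dense_span := by
    refine ((EquivLike.surjective τ).denseRange.dense_image (StarAlgEquiv.isometry τ).continuous
      t.dense_span).mono ?_
    rintro _ ⟨x, hx, rfl⟩
    induction hx using Submodule.span_induction with
    | mem x hx =>
      obtain ⟨a, b, rfl⟩ := hx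
      exact Submodule.subset_span ⟨a, b, rfl⟩
    | zero => rw [map_zero]; exact zero_mem _
    | add x y _ _ hx hy => rw [map_add]; exact add_mem hx hy
    | smul c x _ hx => rw [map_smul]; exact Submodule.smul_mem _ c hx

theorem hom_ext {C : Type x} [NonUnitalCStarAlgebra C] (t : CStarTensor A B T)
    {f g : T →⋆ₙₐ[ℂ] C} (hfg : ∀ a b, f (t.tmul a b) = g (t.tmul a b)) : f = g := by
  have hcont (k : T →⋆ₙₐ[ℂ] C) : Continuous k :=
    AddMonoidHomClass.continuous_of_bound k 1 fun b => by
      simpa using NonUnitalStarAlgHom.norm_apply_le k b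
  refine DFunLike.coe_injective (Continuous.ext_on t.dense_span (hcont f) (hcont g) ?_)
  intro x hx
  induction hx using Submodule.span_induction with
  | mem x hx =>
    obtain ⟨a, b, rfl⟩ := hx
    exact hfg a b
  | zero => rw [map_zero, map_zero]
  | add x y _ _ hx hy => rw [map_add, map_add, hx, hy]
  | smul c x _ hx => rw [map_smul, map_smul, hx]

end CStarTensor

/-- Minimality of `D ⊗ D` as a unital map, for C*-tensor products carried by the same algebra
`T`; the isomorphism `φ` moves `T` into the universe over which minimality quantifies. -/
theorem MinTensor.exists_starAlgHom {D : Type u} {T : Type w} [CStarAlgebra D] [CStarAlgebra T]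
    (h : MinTensor D D T) (hu : h.tmul 1 1 = 1) (φ : D ≃⋆ₐ[ℂ] T) (t : CStarTensor D D T)
    (ht : t.tmul 1 1 = 1) :
    ∃ π : T →⋆ₐ[ℂ] T, ∀ a b, π (t.tmul a b) = h.tmul a b := by
  obtain ⟨π, hπ⟩ := h.minimal D (t.congr φ.symm)
  let ρ : T →⋆ₙₐ[ℂ] T := π.comp (φ.symm : T →⋆ₙₐ[ℂ] D)
  have hρ (a b : D) : ρ (t.tmul a b) = h.tmul a b := hπ a b
  have hρ1 : ρ 1 = 1 := by rw [← ht, hρ, hu, ht]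
  refine ⟨{ AlgHom.ofLinearMap (ρ : T →ₗ[ℂ] T) hρ1 (map_mul ρ) with
    map_star' := map_star ρ }, hρ⟩

/-- A separable, unital, strongly self-absorbing C*-algebra has approximately inner
half flip. -/
theorem stmt_1 {D : Type u} {T : Type w} [CStarAlgebra D] [CStarAlgebra T]
    [TopologicalSpace.SeparableSpace D]
    (h : MinTensor D D T) (hu : h.tmul 1 1 = 1)
    (hssa : IsStronglySelfAbsorbing h) :
    HasApproxInnerHalfFlip h := by
  obtain ⟨-, φ, hφ⟩ := hssa
  obtain ⟨σ, hσ⟩ := h.exists_starAlgHom hu φ h.toCStarTensor.swap hu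
  replace hσ (a b : D) : σ (h.tmul b a) = h.tmul a b := hσ a b
  have hσσ (x : T) : σ (σ x) = x := by
    have e : (σ.comp σ : T →⋆ₙₐ[ℂ] T) = (StarAlgHom.id ℂ T : T →⋆ₙₐ[ℂ] T) :=
      h.toCStarTensor.hom_ext fun a b => by
        change σ (σ (h.tmul a b)) = h.tmul a b
        rw [hσ, hσ]
    exact DFunLike.congr_fun e x
  -- The flip, transported to `D` along `φ`.
  let ψ : D →⋆ₙₐ[ℂ] D :=
    (φ.symm : T →⋆ₙₐ[ℂ] D).comp ((σ : T →⋆ₙₐ[ℂ] T).comp (φ : D →⋆ₙₐ[ℂ] T))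
  have hφψ (a : D) : φ (ψ a) = σ (φ a) := φ.apply_symm_apply _
  have hψψ (a : D) : ψ (ψ a) = a := (EquivLike.injective φ) (by rw [hφψ, hφψ, hσσ])
  let Ψ : D ≃⋆ₐ[ℂ] D :=
    StarAlgEquiv.ofBijective ψ ⟨Function.LeftInverse.injective hψψ,
      Function.RightInverse.surjective hψψ⟩
  obtain ⟨ρ, hρ⟩ := h.exists_starAlgHom hu φ (h.toCStarTensor.congrLeft Ψ)
    (show h.tmul (Ψ 1) 1 = 1 by rw [map_one, hu])
  replace hρ (a b : D) : ρ (h.tmul (ψ a) b) = h.tmul a b := hρ a b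
  have hsnd : ApproxUnitaryEquiv (h.fst ∘ ψ) h.snd := by
    have h1 := hφ.comp_left σ
    have h2 := hφ.symm.comp_right ψ
    have e1 : ⇑φ ∘ ⇑ψ = ⇑σ ∘ ⇑φ := funext hφψ
    have e2 : ⇑σ ∘ h.fst = h.snd := funext fun a => hσ 1 a
    rw [e1] at h2
    rw [e2] at h1
    exact h2.trans h1
  have h3 := hsnd.comp_left ρ
  have e1 : ⇑ρ ∘ h.fst ∘ ⇑ψ = h.fst := funext fun a => hρ a 1
  have e2 : ⇑ρ ∘ h.snd = h.snd := funext fun a => by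
    have h1 : ψ 1 = 1 := map_one Ψ
    have h2 := hρ 1 a
    rwa [h1] at h2
  rwa [e1, e2] at h3
end
end

section
/- If D is a separable, unital, strongly self-absorbing C*-algebra, then D ≅ D^⊗k for every k ∈ ℕ, D ≅ D^⊗∞, and D has approximately inner flip. -/
open scoped MultiplierAlgebra TensorProduct
open Filter Topology

noncomputable section

universe u v w x

/-- A realization of the system of tensor powers `P n ≅ D^{⊗(n+1)}`, together with the
connecting maps `id ⊗ 1_D : D^{⊗(n+1)} → D^{⊗(n+2)}`. -/
structure IsTensorPowerSystem (D : Type u) [CStarAlgebra D] (P : ℕ → Type u)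
    [∀ n, CStarAlgebra (P n)] where
  base : P 0 ≃⋆ₐ[ℂ] D
  step : ∀ n, MinTensor (P n) D (P (n + 1))
  step_unital : ∀ n, (step n).tmul 1 1 = 1

/-- Data exhibiting `L` as the infinite tensor power `D^{⊗∞}`, i.e. as the inductive limit
of the system `(D^{⊗n}, id ⊗ 1_D)`: compatible injective unital *-homomorphisms
`D^{⊗n} → L` with dense combined range. -/
structure IsInfTensorPower (D : Type u) [CStarAlgebra D] (P : ℕ → Type u)
    [∀ n, CStarAlgebra (P n)] (S : IsTensorPowerSystem D P) (L : Type v)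
    [CStarAlgebra L] where
  ι : ∀ n, P n →⋆ₐ[ℂ] L
  compat : ∀ n x, ι (n + 1) ((S.step n).tmul x 1) = ι n x
  injective : ∀ n, Function.Injective (ι n)
  dense : Dense (⋃ n, Set.range (ι n))

section ApproximateUnitaryEquivalence

/-- Two maps into a unital C*-algebra are *locally unitarily equivalent* if on every finite set
they agree, up to an arbitrarily small error, after conjugation by a unitary. -/
def LocalUnitaryEquiv {A : Type*} {B : Type*} [CStarAlgebra B] (φ ψ : A → B) : Prop :=
  ∀ (F : Finset A) (ε : ℝ), 0 < ε →
    ∃ u : unitary B, ∀ a ∈ F, ‖Unitary.conjStarAlgAut ℂ B u (φ a) - ψ a‖ < ε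

namespace LocalUnitaryEquiv

variable {A A' B C : Type*} [CStarAlgebra B] [CStarAlgebra C] {φ ψ χ : A → B}

theorem symm (h : LocalUnitaryEquiv φ ψ) : LocalUnitaryEquiv ψ φ := by
  intro F ε hε
  obtain ⟨u, hu⟩ := h F ε hε
  refine ⟨star u, fun a ha => ?_⟩
  rw [← Unitary.conjStarAlgAut_symm, ← StarAlgEquiv.norm_map (Unitary.conjStarAlgAut ℂ B u),
    map_sub, StarAlgEquiv.apply_symm_apply, norm_sub_rev]
  exact hu a ha

theorem trans (h : LocalUnitaryEquiv φ ψ) (h' : LocalUnitaryEquiv ψ χ) :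
    LocalUnitaryEquiv φ χ := by
  intro F ε hε
  obtain ⟨u, hu⟩ := h F (ε / 2) (half_pos hε)
  obtain ⟨v, hv⟩ := h' F (ε / 2) (half_pos hε)
  refine ⟨v * u, fun a ha => ?_⟩
  have hu' := hu a ha
  rw [← StarAlgEquiv.norm_map (Unitary.conjStarAlgAut ℂ B v), map_sub] at hu'
  have hv' := hv a ha
  rw [map_mul, StarAlgEquiv.mul_apply]
  calc _ ≤ _ := norm_sub_le_norm_sub_add_norm_sub _
          (Unitary.conjStarAlgAut ℂ B v (ψ a)) _
    _ < ε := by linarith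

theorem comp_right (h : LocalUnitaryEquiv φ ψ) (k : A' → A) :
    LocalUnitaryEquiv (φ ∘ k) (ψ ∘ k) := by
  classical
  intro F ε hε
  obtain ⟨u, hu⟩ := h (F.image k) ε hε
  exact ⟨u, fun a ha => hu _ (Finset.mem_image_of_mem k ha)⟩

theorem comp_left (h : LocalUnitaryEquiv φ ψ) (Θ : B ≃⋆ₐ[ℂ] C) :
    LocalUnitaryEquiv (Θ ∘ φ) (Θ ∘ ψ) := by
  intro F ε hε
  obtain ⟨u, hu⟩ := h F ε hε
  refine ⟨⟨Θ u, Unitary.map_mem Θ u.2⟩, fun a ha => ?_⟩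
  have := hu a ha
  rw [← StarAlgEquiv.norm_map Θ, map_sub] at this
  simpa [map_star] using this

end LocalUnitaryEquiv

/-- Every multiplier of a unital C*-algebra comes from the algebra. -/
theorem exists_coe_eq_of_unital {B : Type*} [CStarAlgebra B] (m : 𝓜(ℂ, B)) :
    ∃ b : B, (b : 𝓜(ℂ, B)) = m := by
  have hfst : ∀ y, m.snd 1 * y = m.fst y := fun y => by simpa using m.central 1 y
  have hsnd : ∀ x, m.snd x = x * m.snd 1 := fun x => by
    rw [← mul_one (m.snd x), m.central x 1, ← hfst 1, mul_one]
  refine ⟨m.snd 1, ?_⟩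
  refine DoubleCentralizer.ext ℂ B _ _ (Prod.ext ?_ ?_)
  · ext y
    simpa using hfst y
  · ext x
    simpa using (hsnd x).symm

theorem coe_multiplier_injective {B : Type*} [CStarAlgebra B] :
    Function.Injective (fun b : B => (b : 𝓜(ℂ, B))) := by
  intro a b hab
  have := congrArg (fun m : 𝓜(ℂ, B) => m.fst 1) hab
  simpa using this

theorem coe_multiplier_one {B : Type*} [CStarAlgebra B] :
    ((1 : B) : 𝓜(ℂ, B)) = 1 := by
  refine DoubleCentralizer.ext ℂ B _ _ (Prod.ext ?_ ?_) <;> ext y <;> simp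

theorem coe_multiplier_star_mul_mul_sub {B : Type*} [CStarAlgebra B] (u x y : B) :
    star (u : 𝓜(ℂ, B)) * (x : 𝓜(ℂ, B)) * (u : 𝓜(ℂ, B)) - (y : 𝓜(ℂ, B)) =
      ((star u * x * u - y : B) : 𝓜(ℂ, B)) := by
  have hmul := map_mul (DoubleCentralizer.coeHom (𝕜 := ℂ) (A := B))
  have hstar := map_star (DoubleCentralizer.coeHom (𝕜 := ℂ) (A := B))
  have hsub := map_sub (DoubleCentralizer.coeHom (𝕜 := ℂ) (A := B))
  have := hsub (star u * x * u) y
  rw [hmul, hmul, hstar] at this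
  exact this.symm

theorem norm_coe_multiplier {B : Type*} [CStarAlgebra B] (b : B) : ‖(b : 𝓜(ℂ, B))‖ = ‖b‖ :=
  NonUnitalStarAlgHom.norm_map (DoubleCentralizer.coeHom (𝕜 := ℂ) (A := B))
    coe_multiplier_injective b

theorem coe_mem_unitary_multiplier_iff {B : Type*} [CStarAlgebra B] (b : B) :
    (b : 𝓜(ℂ, B)) ∈ unitary 𝓜(ℂ, B) ↔ b ∈ unitary B := by
  have hmul := map_mul (DoubleCentralizer.coeHom (𝕜 := ℂ) (A := B))
  have hstar := map_star (DoubleCentralizer.coeHom (𝕜 := ℂ) (A := B))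
  have h1 : star (b : 𝓜(ℂ, B)) * (b : 𝓜(ℂ, B)) = ((star b * b : B) : 𝓜(ℂ, B)) := by
    have := hmul (star b) b
    rw [hstar] at this
    exact this.symm
  have h2 : (b : 𝓜(ℂ, B)) * star (b : 𝓜(ℂ, B)) = ((b * star b : B) : 𝓜(ℂ, B)) := by
    have := hmul b (star b)
    rw [hstar] at this
    exact this.symm
  rw [Unitary.mem_iff, Unitary.mem_iff, h1, h2, ← coe_multiplier_one,
    coe_multiplier_injective.eq_iff, coe_multiplier_injective.eq_iff]

theorem norm_conj_multiplier_sub {B : Type*} [CStarAlgebra B] (u : unitary B) (x y : B) :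
    ‖star ((u : B) : 𝓜(ℂ, B)) * (x : 𝓜(ℂ, B)) * ((u : B) : 𝓜(ℂ, B)) - (y : 𝓜(ℂ, B))‖ =
      ‖Unitary.conjStarAlgAut ℂ B (star u) x - y‖ := by
  rw [coe_multiplier_star_mul_mul_sub, norm_coe_multiplier,
    Unitary.conjStarAlgAut_star_apply]

theorem ApproxUnitaryEquiv.localUnitaryEquiv {A : Type*} {B : Type*} [CStarAlgebra B]
    {φ ψ : A → B} (h : ApproxUnitaryEquiv φ ψ) : LocalUnitaryEquiv φ ψ := by
  obtain ⟨v, hv, hlim⟩ := h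
  intro F ε hε
  have hev : ∀ᶠ n in atTop, ∀ a ∈ F,
      ‖star (v n) * (φ a : 𝓜(ℂ, B)) * v n - (ψ a : 𝓜(ℂ, B))‖ < ε :=
    (Filter.eventually_all_finset F).2 fun a _ => (hlim a).eventually_lt_const hε
  obtain ⟨n, hn⟩ := hev.exists
  obtain ⟨u, hu⟩ := exists_coe_eq_of_unital (v n)
  have huu : u ∈ unitary B := (coe_mem_unitary_multiplier_iff u).1 (hu ▸ hv n)
  refine ⟨star ⟨u, huu⟩, fun a ha => ?_⟩
  rw [← norm_conj_multiplier_sub, hu]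
  exact hn a ha

theorem LocalUnitaryEquiv.approxUnitaryEquiv {A : Type*} {B : Type*} [PseudoMetricSpace A]
    [TopologicalSpace.SeparableSpace A] [CStarAlgebra B] {φ ψ : A → B} (hφ : Isometry φ)
    (hψ : Isometry ψ) (h : LocalUnitaryEquiv φ ψ) : ApproxUnitaryEquiv φ ψ := by
  classical
  rcases isEmpty_or_nonempty A with hA | hA
  · exact ⟨fun _ => 1, fun _ => one_mem _, fun a => isEmptyElim a⟩
  have hd := TopologicalSpace.denseRange_denseSeq A
  set d := TopologicalSpace.denseSeq A
  choose u hu using fun n : ℕ => h ((Finset.range (n + 1)).image d)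
    (1 / ((n : ℝ) + 1)) (by positivity)
  refine ⟨fun n => ((star (u n) : unitary B) : B),
    fun n => (coe_mem_unitary_multiplier_iff _).2 (star (u n)).2, fun a => ?_⟩
  simp only [norm_conj_multiplier_sub, star_star]
  rw [Metric.tendsto_atTop]
  intro ε hε
  obtain ⟨i, hi⟩ := hd.exists_dist_lt a (ε := ε / 3) (by positivity)
  obtain ⟨N, hN⟩ := exists_nat_one_div_lt (show (0 : ℝ) < ε / 3 by positivity)
  refine ⟨max i N, fun n hn => ?_⟩
  rw [Real.dist_0_eq_abs, abs_norm, ← dist_eq_norm]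
  have h1 := hu n (d i) (Finset.mem_image_of_mem _
    (Finset.mem_range_succ_iff.2 ((le_max_left _ _).trans hn)))
  have h2 : 1 / ((n : ℝ) + 1) ≤ 1 / ((N : ℝ) + 1) :=
    Nat.one_div_le_one_div ((le_max_right _ _).trans hn)
  have h3 : dist (Unitary.conjStarAlgAut ℂ B (u n) (φ a))
      (Unitary.conjStarAlgAut ℂ B (u n) (φ (d i))) < ε / 3 := by
    rwa [(StarAlgEquiv.isometry (Unitary.conjStarAlgAut ℂ B (u n))).dist_eq, hφ.dist_eq]
  have h4 : dist (ψ (d i)) (ψ a) < ε / 3 := by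
    rwa [hψ.dist_eq, dist_comm]
  rw [← dist_eq_norm] at h1
  linarith [dist_triangle4 (Unitary.conjStarAlgAut ℂ B (u n) (φ a))
    (Unitary.conjStarAlgAut ℂ B (u n) (φ (d i))) (ψ (d i)) (ψ a)]

end ApproximateUnitaryEquivalence

section Functoriality

variable {A A' B B' T T' : Type u} [CStarAlgebra A] [CStarAlgebra A'] [CStarAlgebra B]
  [CStarAlgebra B'] [CStarAlgebra T] [CStarAlgebra T']

/-- Precomposition of a C*-tensor product with isomorphisms of both factors. -/
def CStarTensor.precomp (h : CStarTensor A' B' T) (α : A ≃⋆ₐ[ℂ] A') (β : B ≃⋆ₐ[ℂ] B') :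
    CStarTensor A B T where
  tmul a b := h.tmul (α a) (β b)
  add_left a a' b := by rw [map_add, h.add_left]
  add_right a b b' := by rw [map_add, h.add_right]
  smul_left c a b := by rw [map_smul, h.smul_left]
  smul_right c a b := by rw [map_smul, h.smul_right]
  mul_tmul a a' b b' := by rw [h.mul_tmul, map_mul, map_mul]
  star_tmul a b := by rw [h.star_tmul, map_star, map_star]
  norm_tmul a b := by rw [h.norm_tmul, StarAlgEquiv.norm_map, StarAlgEquiv.norm_map]
  dense_span := by
    have : {t : T | ∃ a b, h.tmul (α a) (β b) = t} = {t : T | ∃ a b, h.tmul a b = t} := by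
      ext t
      constructor
      · rintro ⟨a, b, rfl⟩
        exact ⟨_, _, rfl⟩
      · rintro ⟨a, b, rfl⟩
        exact ⟨α.symm a, β.symm b, by simp⟩
    rw [this]
    exact h.dense_span

/-- Exchange of the two factors of a C*-tensor product. -/
def CStarTensor.swap_s6 (h : CStarTensor A B T) : CStarTensor B A T where
  tmul b a := h.tmul a b
  add_left b b' a := h.add_right a b b'
  add_right b a a' := h.add_left a a' b
  smul_left c b a := h.smul_right c a b
  smul_right c b a := h.smul_left c a b
  mul_tmul b b' a a' := h.mul_tmul a a' b b'
  star_tmul b a := h.star_tmul a b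
  norm_tmul b a := by rw [h.norm_tmul, mul_comm]
  dense_span := by
    have : {t : T | ∃ b a, h.tmul a b = t} = {t : T | ∃ a b, h.tmul a b = t} := by
      ext t
      exact exists_comm
    rw [this]
    exact h.dense_span

/-- A star homomorphism fixing all elementary tensors is the identity. -/
theorem CStarTensor.eq_id_of_tmul (h : CStarTensor A B T) (π : T →⋆ₙₐ[ℂ] T)
    (hπ : ∀ a b, π (h.tmul a b) = h.tmul a b) (t : T) : π t = t := by
  have hle : Submodule.span ℂ {t : T | ∃ a b, h.tmul a b = t} ≤
      LinearMap.eqLocus (π : T →ₗ[ℂ] T) LinearMap.id := by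
    refine Submodule.span_le.2 ?_
    rintro _ ⟨a, b, rfl⟩
    exact hπ a b
  have hcont : Continuous π := AddMonoidHomClass.continuous_of_bound π 1 fun t => by
    simpa using NonUnitalStarAlgHom.norm_apply_le π t
  exact congrFun (hcont.ext_on h.dense_span continuous_id fun t ht => hle ht) t

/-- Mutually inverse star homomorphisms on elementary tensors yield an isomorphism. -/
theorem CStarTensor.exists_starAlgEquiv (h : CStarTensor A B T) (h' : CStarTensor A B T')
    (π : T →⋆ₙₐ[ℂ] T') (π' : T' →⋆ₙₐ[ℂ] T) (hπ : ∀ a b, π (h.tmul a b) = h'.tmul a b)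
    (hπ' : ∀ a b, π' (h'.tmul a b) = h.tmul a b) :
    ∃ Θ : T ≃⋆ₐ[ℂ] T', ∀ a b, Θ (h.tmul a b) = h'.tmul a b := by
  have h1 : ∀ t, π' (π t) = t :=
    h.eq_id_of_tmul (π'.comp π) fun a b => by simp [hπ, hπ']
  have h2 : ∀ t, π (π' t) = t :=
    h'.eq_id_of_tmul (π.comp π') fun a b => by simp [hπ, hπ']
  exact ⟨StarAlgEquiv.ofBijective π
    (Function.bijective_iff_has_inverse.2 ⟨π', h1, h2⟩), hπ⟩

/-- Functoriality of the minimal tensor product with respect to isomorphisms. -/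
theorem MinTensor.exists_map (h : MinTensor A B T) (h' : MinTensor A' B' T')
    (α : A ≃⋆ₐ[ℂ] A') (β : B ≃⋆ₐ[ℂ] B') :
    ∃ Θ : T ≃⋆ₐ[ℂ] T', ∀ a b, Θ (h.tmul a b) = h'.tmul (α a) (β b) := by
  obtain ⟨π', hπ'⟩ := h.minimal T' (h'.toCStarTensor.precomp α β)
  obtain ⟨π, hπ⟩ := h'.minimal T (h.toCStarTensor.precomp α.symm β.symm)
  refine h.toCStarTensor.exists_starAlgEquiv (h'.toCStarTensor.precomp α β) π π'
    (fun a b => ?_) hπ'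
  simpa [CStarTensor.precomp] using hπ (α a) (β b)

/-- The flip automorphism of `A ⊗ A`. -/
theorem MinTensor.exists_flip (h : MinTensor A A T) :
    ∃ σ : T ≃⋆ₐ[ℂ] T, ∀ a b, σ (h.tmul a b) = h.tmul b a := by
  obtain ⟨π, hπ⟩ := h.minimal T h.toCStarTensor.swap_s6
  exact h.toCStarTensor.exists_starAlgEquiv h.toCStarTensor.swap_s6 π π
    (fun a b => hπ b a) hπ

end Functoriality

section ApproximateIntertwining

/-- One-sided approximate intertwining: if `D` is isomorphic to every algebra in an increasing
sequence with dense union, and each isomorphism can be extended to the next stage up to an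
arbitrarily small error on finite sets, then `D` is isomorphic to the limit. -/
theorem nonempty_starAlgEquiv_of_approx_intertwining {D : Type*} [CStarAlgebra D]
    [TopologicalSpace.SeparableSpace D] {L : Type*} [CStarAlgebra L] {P : ℕ → Type*}
    [∀ n, CStarAlgebra (P n)] (ι : ∀ n, P n →⋆ₐ[ℂ] L) (hι : ∀ n, Function.Injective (ι n))
    (j : ∀ n, P n → P (n + 1)) (hj : ∀ n x, ι (n + 1) (j n x) = ι n x)
    (hdense : Dense (⋃ n, Set.range (ι n))) (θ₀ : D ≃⋆ₐ[ℂ] P 0)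
    (hext : ∀ n (θ : D ≃⋆ₐ[ℂ] P n) (F : Finset D) (ε : ℝ), 0 < ε →
      ∃ θ' : D ≃⋆ₐ[ℂ] P (n + 1), ∀ a ∈ F, ‖θ' a - j n (θ a)‖ < ε) :
    Nonempty (D ≃⋆ₐ[ℂ] L) := by
  classical
  have hιiso : ∀ n, Isometry (ι n) := fun n => NonUnitalStarAlgHom.isometry (ι n) (hι n)
  have hd := TopologicalSpace.denseRange_denseSeq D
  set d := TopologicalSpace.denseSeq D
  let p : ∀ n m, P n → P (n + m) := fun n m x => Nat.rec x (fun m y => j (n + m) y) m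
  have hp : ∀ n m x, ι (n + m) (p n m x) = ι n x := by
    intro n m x
    induction m with
    | zero => rfl
    | succ m ih => exact (hj (n + m) _).trans ih
  have hmono : ∀ {n m : ℕ}, n ≤ m → Set.range (ι n) ⊆ Set.range (ι m) := by
    rintro n m hnm _ ⟨x, rfl⟩
    obtain ⟨k, rfl⟩ := Nat.exists_eq_add_of_le hnm
    exact ⟨p n k x, hp n k x⟩
  have hiso : ∀ n, Nonempty (D ≃⋆ₐ[ℂ] P n) := fun n => by
    induction n with
    | zero => exact ⟨θ₀⟩
    | succ n ih =>
      obtain ⟨θ⟩ := ih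
      obtain ⟨θ', -⟩ := hext n θ ∅ 1 one_pos
      exact ⟨θ'⟩
  let θ₁ : ∀ n, D ≃⋆ₐ[ℂ] P n := fun n => (hiso n).some
  -- a dense sequence in `L` whose `i`-th term lies in the `i`-th stage
  let e₂ : ℕ × ℕ → L := fun k => ι k.1 (θ₁ k.1 (d k.2))
  let e : ℕ → L := fun i => e₂ i.unpair
  have he : ∀ {i n : ℕ}, i ≤ n → e i ∈ Set.range (ι n) := fun {i n} hin =>
    hmono ((Nat.unpair_left_le i).trans hin) ⟨_, rfl⟩
  have hedense : DenseRange e := by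
    intro y
    rw [Metric.mem_closure_iff]
    intro ε hε
    obtain ⟨z, hz, hyz⟩ := Metric.mem_closure_iff.1 (hdense y) (ε / 2) (half_pos hε)
    obtain ⟨n, x, rfl⟩ := Set.mem_iUnion.1 hz
    obtain ⟨k, hk⟩ := hd.exists_dist_lt ((θ₁ n).symm x) (half_pos hε)
    refine ⟨_, ⟨Nat.pair n k, rfl⟩, ?_⟩
    have : dist (ι n x) (e (Nat.pair n k)) < ε / 2 := by
      rw [show e (Nat.pair n k) = e₂ (n, k) from congrArg e₂ (Nat.unpair_pair n k),
        (hιiso n).dist_eq]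
      rwa [← (StarAlgEquiv.isometry (θ₁ n)).dist_eq, StarAlgEquiv.apply_symm_apply] at hk
    linarith [dist_triangle y (ι n x) (e (Nat.pair n k))]
  choose q hq using fun (n : ℕ) (i : Fin (n + 1)) => he (Nat.lt_succ_iff.1 i.2)
  choose next hnext using fun n (s : (D ≃⋆ₐ[ℂ] P n) × Finset D) =>
    hext n s.1 s.2 ((1 / 2) ^ n) (by positivity)
  -- finite subsets of `D` are accumulated along the construction
  let enlarge : ∀ n, (D ≃⋆ₐ[ℂ] P n) → Finset D → Finset D := fun n θ F =>
    F ∪ {d n} ∪ Finset.univ.image fun i => θ.symm (q n i)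
  let s : ∀ n, (D ≃⋆ₐ[ℂ] P n) × Finset D := fun n =>
    Nat.rec (θ₀, enlarge 0 θ₀ ∅)
      (fun n s => (next n s, enlarge (n + 1) (next n s) s.2)) n
  let g : ℕ → D → L := fun n a => ι n ((s n).1 a)
  have hgiso : ∀ n, Isometry (g n) := fun n => (hιiso n).comp (StarAlgEquiv.isometry (s n).1)
  have hFsucc : ∀ n, (s n).2 ⊆ (s (n + 1)).2 := fun n a ha => by
    change a ∈ enlarge (n + 1) _ _
    simp only [enlarge, Finset.mem_union]
    exact Or.inl (Or.inl ha)
  have hFmono : Monotone fun n => (s n).2 := monotone_nat_of_le_succ hFsucc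
  have hF : ∀ n, ∃ F, (s n).2 = enlarge n (s n).1 F := fun n => by
    cases n with
    | zero => exact ⟨∅, rfl⟩
    | succ n => exact ⟨(s n).2, rfl⟩
  have hdF : ∀ n, d n ∈ (s n).2 := fun n => by
    obtain ⟨F, hF⟩ := hF n
    simp [hF, enlarge]
  have hqF : ∀ n i, (s n).1.symm (q n i) ∈ (s n).2 := fun n i => by
    obtain ⟨F, hF⟩ := hF n
    rw [hF]
    simp [enlarge]
  have hstep : ∀ n, ∀ a ∈ (s n).2, dist (g n a) (g (n + 1) a) ≤ (1 / 2) ^ n := by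
    intro n a ha
    have := hnext n (s n) a ha
    rw [← dist_eq_norm, ← (hιiso (n + 1)).dist_eq, hj, dist_comm] at this
    exact this.le
  have hstep' : ∀ N, ∀ a ∈ (s N).2, ∀ n,
      dist (g (n + N) a) (g (n + 1 + N) a) ≤ (1 / 2) ^ N * (1 / 2) ^ n := by
    intro N a ha n
    have := hstep (n + N) a (hFmono (Nat.le_add_left N n) ha)
    rwa [pow_add, mul_comm, Nat.add_right_comm] at this
  have hcauchyF : ∀ N, ∀ a ∈ (s N).2, CauchySeq fun n => g n a := fun N a ha =>
    (cauchySeq_shift N).1 (cauchySeq_of_le_geometric _ _ (by norm_num) (hstep' N a ha))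
  have hcauchy : ∀ a, CauchySeq fun n => g n a := by
    intro a
    rw [Metric.cauchySeq_iff]
    intro ε hε
    obtain ⟨i, hi⟩ := hd.exists_dist_lt a (ε := ε / 3) (by positivity)
    obtain ⟨N, hN⟩ := Metric.cauchySeq_iff.1 (hcauchyF i (d i) (hdF i)) (ε / 3) (by positivity)
    refine ⟨N, fun m hm n hn => ?_⟩
    have h1 : dist (g m a) (g m (d i)) < ε / 3 := by rwa [(hgiso m).dist_eq]
    have h2 : dist (g n (d i)) (g n a) < ε / 3 := by rwa [(hgiso n).dist_eq, dist_comm]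
    linarith [hN m hm n hn, dist_triangle4 (g m a) (g m (d i)) (g n (d i)) (g n a)]
  choose G hG using fun a => cauchySeq_tendsto_of_complete (hcauchy a)
  have hGiso : Isometry G := Isometry.of_dist_eq fun a b =>
    tendsto_nhds_unique ((hG a).dist (hG b)) (by simp only [(hgiso _).dist_eq, tendsto_const_nhds])
  let Φ : D →⋆ₙₐ[ℂ] L :=
    { toFun := G
      map_smul' := fun c a => tendsto_nhds_unique (hG (c • a))
        (((hG a).const_smul c).congr fun n => by simp [g])
      map_zero' := tendsto_nhds_unique (hG 0)
        (tendsto_const_nhds.congr fun n => by simp [g])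
      map_add' := fun a b => tendsto_nhds_unique (hG (a + b))
        (((hG a).add (hG b)).congr fun n => by simp [g])
      map_mul' := fun a b => tendsto_nhds_unique (hG (a * b))
        (((hG a).mul (hG b)).congr fun n => by simp [g])
      map_star' := fun a => tendsto_nhds_unique (hG (star a))
        ((hG a).star.congr fun n => by simp [g, map_star]) }
  have hclosed : IsClosed (Set.range G) := hGiso.isClosedEmbedding.isClosed_range
  have hmem : ∀ i, e i ∈ Set.range G := by
    intro i
    rw [← hclosed.closure_eq, Metric.mem_closure_iff]
    intro ε hε
    obtain ⟨M, hM⟩ := exists_pow_lt_of_lt_one (half_pos hε) (show (1 / 2 : ℝ) < 1 by norm_num)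
    set N := max i M
    have hiN : i ≤ N := le_max_left _ _
    set a := (s N).1.symm (q N ⟨i, Nat.lt_succ_iff.2 hiN⟩)
    refine ⟨G a, ⟨a, rfl⟩, ?_⟩
    have hga : g N a = e i := by
      simp only [g, a, StarAlgEquiv.apply_symm_apply]
      exact hq N ⟨i, Nat.lt_succ_iff.2 hiN⟩
    have hlim : Tendsto (fun n => g (n + N) a) atTop (𝓝 (G a)) :=
      (tendsto_add_atTop_iff_nat N).2 (hG a)
    have hle := dist_le_of_le_geometric_of_tendsto₀ (1 / 2 : ℝ) ((1 / 2) ^ N) (by norm_num)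
      (hstep' N a (hqF N _)) hlim
    rw [Nat.zero_add, hga] at hle
    have hpow : (1 / 2 : ℝ) ^ N ≤ (1 / 2) ^ M :=
      pow_le_pow_of_le_one (by norm_num) (by norm_num) (le_max_right _ _)
    have : (1 / 2 : ℝ) ^ N / (1 - 1 / 2) = 2 * (1 / 2) ^ N := by ring
    linarith
  have hsurj : Function.Surjective G := by
    rw [← Set.range_eq_univ, ← hclosed.closure_eq]
    exact (hedense.mono (Set.range_subset_iff.2 hmem)).closure_eq
  exact ⟨StarAlgEquiv.ofBijective Φ ⟨hGiso.injective, hsurj⟩⟩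

end ApproximateIntertwining

section StronglySelfAbsorbing

variable {D T E T' : Type u} [CStarAlgebra D] [CStarAlgebra T] [CStarAlgebra E] [CStarAlgebra T']

/-- If `φ : D ≅ D ⊗ D` is locally unitarily equivalent to `id ⊗ 1`, then every automorphism
of `D` is locally inner. -/
theorem MinTensor.localUnitaryEquiv_id (h : MinTensor D D T) (φ : D ≃⋆ₐ[ℂ] T)
    (hφ : LocalUnitaryEquiv φ h.fst) (α : D ≃⋆ₐ[ℂ] D) :
    LocalUnitaryEquiv α (id : D → D) := by
  obtain ⟨σ, hσ⟩ := h.exists_flip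
  obtain ⟨β, hβ⟩ := h.exists_map h (StarAlgEquiv.refl ℂ D) α
  have hβfst : β ∘ h.fst = h.fst := by
    ext a
    simp [MinTensor.fst, hβ]
  have hβφ : LocalUnitaryEquiv (β ∘ φ) φ := by
    have := hφ.comp_left β
    rw [hβfst] at this
    exact this.trans hφ.symm
  have hβid : LocalUnitaryEquiv β (id : T → T) := by
    convert hβφ.comp_right φ.symm using 1 <;> ext t <;> simp
  have hα1 : LocalUnitaryEquiv (h.fst ∘ α) h.fst := by
    convert (hβid.comp_right h.snd).comp_left σ using 1 <;> ext a <;>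
      simp [MinTensor.fst, MinTensor.snd, hβ, hσ]
  have hφα : LocalUnitaryEquiv (φ ∘ α) φ :=
    ((hφ.comp_right α).trans hα1).trans hφ.symm
  convert hφα.comp_left φ.symm using 1 <;> ext a <;> simp

theorem MinTensor.localUnitaryEquiv_flip (h : MinTensor D D T) (φ : D ≃⋆ₐ[ℂ] T)
    (hφ : LocalUnitaryEquiv φ h.fst) (σ : T ≃⋆ₐ[ℂ] T) :
    LocalUnitaryEquiv σ (id : T → T) := by
  have := ((h.localUnitaryEquiv_id φ hφ ((φ.trans σ).trans φ.symm)).comp_left φ).comp_right φ.symm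
  convert this using 1 <;> ext t <;> simp

/-- An isomorphism `D ≅ E` extends to an isomorphism `D ≅ E ⊗ D`, up to a small error on finite
sets, when `D ≅ D ⊗ D` via a map locally unitarily equivalent to `id ⊗ 1`. -/
theorem MinTensor.exists_starAlgEquiv_approx (h : MinTensor D D T) (φ : D ≃⋆ₐ[ℂ] T)
    (hφ : LocalUnitaryEquiv φ h.fst) (h' : MinTensor E D T') (θ : D ≃⋆ₐ[ℂ] E)
    (F : Finset D) (ε : ℝ) (hε : 0 < ε) :
    ∃ θ' : D ≃⋆ₐ[ℂ] T', ∀ a ∈ F, ‖θ' a - h'.tmul (θ a) 1‖ < ε := by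
  obtain ⟨Θ, hΘ⟩ := h.exists_map h' θ (StarAlgEquiv.refl ℂ D)
  obtain ⟨u, hu⟩ := hφ F ε hε
  refine ⟨(φ.trans (Unitary.conjStarAlgAut ℂ T u)).trans Θ, fun a ha => ?_⟩
  have hΘa : h'.tmul (θ a) 1 = Θ (h.fst a) := (hΘ a 1).symm
  rw [hΘa, StarAlgEquiv.trans_apply, StarAlgEquiv.trans_apply, ← map_sub, StarAlgEquiv.norm_map]
  exact hu a ha

end StronglySelfAbsorbing

/-- If `D` is separable, unital and strongly self-absorbing, then `D ≅ D^{⊗k}` for every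
`k ∈ ℕ` (here `P n ≅ D^{⊗(n+1)}`), `D ≅ D^{⊗∞}`, and `D` has approximately inner flip. -/
theorem stmt_6 {D : Type u} {TD : Type u} [CStarAlgebra D] [CStarAlgebra TD]
    [TopologicalSpace.SeparableSpace D]
    (hD : MinTensor D D TD) (hDu : hD.tmul 1 1 = 1)
    (hssa : IsStronglySelfAbsorbing hD)
    (P : ℕ → Type u) [∀ n, CStarAlgebra (P n)]
    (S : IsTensorPowerSystem D P)
    (L : Type v) [CStarAlgebra L] (hL : IsInfTensorPower D P S L) :
    (∀ k : ℕ, Nonempty (D ≃⋆ₐ[ℂ] P k)) ∧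
      Nonempty (D ≃⋆ₐ[ℂ] L) ∧
      HasApproxInnerFlip hD := by
  obtain ⟨-, φ, hφ⟩ := hssa
  have hφ' := hφ.localUnitaryEquiv
  have hext := fun n => hD.exists_starAlgEquiv_approx φ hφ' (S.step n)
  refine ⟨fun k => ?_, ?_, ?_⟩
  · induction k with
    | zero => exact ⟨S.base.symm⟩
    | succ n ih =>
      obtain ⟨θ⟩ := ih
      obtain ⟨θ', -⟩ := hext n θ ∅ 1 one_pos
      exact ⟨θ'⟩
  · exact nonempty_starAlgEquiv_of_approx_intertwining hL.ι hL.injective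
      (fun n x => (S.step n).tmul x 1) hL.compat hL.dense S.base.symm hext
  · obtain ⟨σ, hσ⟩ := hD.exists_flip
    have : TopologicalSpace.SeparableSpace TD :=
      φ.surjective.denseRange.separableSpace (StarAlgEquiv.isometry φ).continuous
    exact ⟨σ, hσ, (hD.localUnitaryEquiv_flip φ hφ' σ).approxUnitaryEquiv
      (StarAlgEquiv.isometry σ) isometry_id⟩
end
end
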